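/- Let r^E be a recursive tournament rule, let T be an independent probabilistic tournament, and let w be a team. Then the probability that w wins when r^E is applied to T equals the expectation, over the gauntlet G^{r^E}_w(T), of the product ∏_{x ∈ G^{r^E}_w(T)} p^T_{wx} of w's win probabilities against its gauntlet opponents: r^E_w(T) = E_{G^{r^E}_w(T)}[ ∏_{x ∈ G^{r^E}_w(T)} p^T_{wx} ]. -/

import Mathlib

open scoped Classical
open Finset

/-! ## Basic tournament notions -/

/-- The set of potential matches among `n` teams: ordered pairs `(i, j)` with `i < j`. -/
abbrev MatchPair (n : ℕ) := {q : Fin n × Fin n // q.1 < q.2}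

/-- A deterministic (round robin) tournament on `n` teams: for each pair `i < j`,
`true` means that `i` beats `j`. -/
abbrev Outcome (n : ℕ) := MatchPair n → Bool

/-- `Outcome.beats o i j` holds when team `i` beats team `j` (it is `false` when `i = j`). -/
def Outcome.beats {n : ℕ} (o : Outcome n) (i j : Fin n) : Bool :=
  if h : i < j then o ⟨(i, j), h⟩
  else if h' : j < i then !o ⟨(j, i), h'⟩
  else false

/-- An independent probabilistic tournament on `n` teams: `p i j` is the probability
that `i` beats `j`, with `p i j + p j i = 1` for `i ≠ j`. -/
structure ProbTournament (n : ℕ) where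
  p : Fin n → Fin n → ℝ
  mem_Icc : ∀ i j : Fin n, p i j ∈ Set.Icc (0 : ℝ) 1
  compl : ∀ i j : Fin n, i ≠ j → p i j + p j i = 1

/-- The probability of the deterministic outcome `o` when all matches are independent
with probabilities given by `T`. -/
noncomputable def ProbTournament.prob {n : ℕ} (T : ProbTournament n) (o : Outcome n) : ℝ :=
  ∏ e : MatchPair n, (if o e then T.p e.val.1 e.val.2 else T.p e.val.2 e.val.1)

/-- `rP r T i`: the probability that team `i` wins when rule `r` is applied to the
independent probabilistic tournament `T`. -/
noncomputable def rP (r : ∀ n : ℕ, Outcome n → Fin n → ℝ) {n : ℕ}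
    (T : ProbTournament n) (i : Fin n) : ℝ :=
  ∑ o : Outcome n, T.prob o * r n o i

/-- `rPS r T S`: the probability that the winner lies in `S`. -/
noncomputable def rPS (r : ∀ n : ℕ, Outcome n → Fin n → ℝ) {n : ℕ}
    (T : ProbTournament n) (S : Finset (Fin n)) : ℝ :=
  ∑ i ∈ S, rP r T i

/-- A tournament rule assigns a probability distribution over the teams to every
deterministic tournament. -/
def IsTournamentRule (r : ∀ n : ℕ, Outcome n → Fin n → ℝ) : Prop :=
  (∀ (n : ℕ) (o : Outcome n) (i : Fin n), 0 ≤ r n o i) ∧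
  (∀ n : ℕ, 0 < n → ∀ o : Outcome n, ∑ i : Fin n, r n o i = 1)

/-- A rule is Condorcet-consistent if an undefeated team wins with probability 1. -/
def CondorcetConsistent (r : ∀ n : ℕ, Outcome n → Fin n → ℝ) : Prop :=
  ∀ (n : ℕ) (o : Outcome n) (i : Fin n),
    (∀ j : Fin n, j ≠ i → Outcome.beats o i j = true) → r n o i = 1

/-- Two independent probabilistic tournaments are `S`-adjacent if they agree on every
match that is not between two members of `S`. -/
def Adjacent {n : ℕ} (S : Finset (Fin n)) (T T' : ProbTournament n) : Prop :=
  ∀ i j : Fin n, ¬(i ∈ S ∧ j ∈ S) → T.p i j = T'.p i j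

/-- Weakly ε-bounded: all match probabilities lie in `[1/2 - ε, 1/2 + ε]`. -/
def WeaklyBounded (ε : ℝ) (n : ℕ) (T : ProbTournament n) : Prop :=
  ∀ i j : Fin n, i ≠ j → T.p i j ∈ Set.Icc (1/2 - ε) (1/2 + ε)

/-- Strictly ε-bounded: all match probabilities lie in `{1/2 - ε, 1/2 + ε}`. -/
def StrictlyBounded (ε : ℝ) (n : ℕ) (T : ProbTournament n) : Prop :=
  ∀ i j : Fin n, i ≠ j → T.p i j = 1/2 - ε ∨ T.p i j = 1/2 + ε

/-- `alph r k C`: the manipulability `α_k^r(C)`, i.e. the supremum over tournaments in the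
class `C` (on any number of teams), sets `S` of at most `k` teams, and `S`-adjacent
manipulations `T'`, of the gain `r_S(T') - r_S(T)`. -/
noncomputable def alph (r : ∀ n : ℕ, Outcome n → Fin n → ℝ) (k : ℕ)
    (C : ∀ n : ℕ, ProbTournament n → Prop) : ℝ :=
  sSup {x : ℝ | ∃ (n : ℕ) (T T' : ProbTournament n) (S : Finset (Fin n)),
    C n T ∧ S.card ≤ k ∧ Adjacent S T T' ∧ x = rPS r T' S - rPS r T S}

/-! ## Anonymity -/

/-- The relabeling of an outcome by a permutation `σ`: in `permOutcome σ o`,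
team `σ i` beats team `σ j` exactly when `i` beats `j` in `o`. -/
def permOutcome {n : ℕ} (σ : Equiv.Perm (Fin n)) (o : Outcome n) : Outcome n :=
  fun e => Outcome.beats o (σ.symm e.val.1) (σ.symm e.val.2)

/-- A tournament rule is anonymous if relabeling the teams relabels the winner
distribution accordingly. -/
def IsAnonymous (r : ∀ n : ℕ, Outcome n → Fin n → ℝ) : Prop :=
  ∀ (n : ℕ) (σ : Equiv.Perm (Fin n)) (o : Outcome n) (i : Fin n),
    r n (permOutcome σ o) (σ i) = r n o i

/-! ## Elimination rules and recursive tournament rules -/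

/-- An elimination rule: for every number `n > 1` of teams, a distribution `d n` over
sets `M` of matches to be played, with `1 ≤ |M| ≤ n - 1` on the support. -/
structure ElimRule where
  d : ∀ n : ℕ, Finset (MatchPair n) → ℝ
  nonneg : ∀ (n : ℕ) (M : Finset (MatchPair n)), 0 ≤ d n M
  sum_one : ∀ n : ℕ, 1 < n → ∑ M : Finset (MatchPair n), d n M = 1
  supp : ∀ (n : ℕ) (M : Finset (MatchPair n)), 1 < n → d n M ≠ 0 →
    1 ≤ M.card ∧ M.card ≤ n - 1

/-- A set of matches is a matching when no team appears in two distinct matches. -/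
def IsMatchingSet {n : ℕ} (M : Finset (MatchPair n)) : Prop :=
  ∀ e ∈ M, ∀ e' ∈ M, e ≠ e' →
    e.val.1 ≠ e'.val.1 ∧ e.val.1 ≠ e'.val.2 ∧ e.val.2 ≠ e'.val.1 ∧ e.val.2 ≠ e'.val.2

/-- A matching elimination rule only ever selects matchings. -/
def ElimRule.IsMatchingRule (E : ElimRule) : Prop :=
  ∀ (n : ℕ) (M : Finset (MatchPair n)), E.d n M ≠ 0 → IsMatchingSet M

/-- Team `i` loses one of the matches in `M` under the outcome `o`. -/
def losesIn {n : ℕ} (o : Outcome n) (M : Finset (MatchPair n)) (i : Fin n) : Prop :=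
  ∃ e ∈ M, (e.val.1 = i ∧ Outcome.beats o e.val.2 i = true) ∨
           (e.val.2 = i ∧ Outcome.beats o e.val.1 i = true)

/-- The teams surviving the matches `M` (i.e. not losing any match of `M`). -/
noncomputable def survivors {n : ℕ} (o : Outcome n) (M : Finset (MatchPair n)) :
    Finset (Fin n) :=
  Finset.univ.filter (fun i => ¬ losesIn o M i)

/-- The induced sub-outcome on the teams of `s`, reindexed by `Fin s.card` in
increasing order. -/
noncomputable def restrictOutcome {n : ℕ} (o : Outcome n) (s : Finset (Fin n)) :
    Outcome s.card :=
  fun e => Outcome.beats o (↑(s.orderIsoOfFin rfl e.val.1)) (↑(s.orderIsoOfFin rfl e.val.2))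

/-- The induced probabilistic subtournament on the teams of `s` (same match
probabilities), reindexed by `Fin s.card` in increasing order. -/
noncomputable def restrictProb {n : ℕ} (T : ProbTournament n) (s : Finset (Fin n)) :
    ProbTournament s.card where
  p a b := T.p ↑(s.orderIsoOfFin rfl a) ↑(s.orderIsoOfFin rfl b)
  mem_Icc _ _ := T.mem_Icc _ _
  compl a b hab := T.compl _ _
    (fun h => hab ((s.orderIsoOfFin rfl).injective (Subtype.coe_injective h)))

/-- The subset of `Fin s.card` corresponding to the members of `S` that lie in `s`. -/
noncomputable def mapTeams {n : ℕ} (s : Finset (Fin n)) (S : Finset (Fin n)) :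
    Finset (Fin s.card) :=
  Finset.univ.filter (fun a => (↑(s.orderIsoOfFin rfl a) : Fin n) ∈ S)

/-- Fueled recursion computing the winner distribution of the recursive tournament rule
`r^E`: sample `M ← E(n)`, eliminate all losers of matches in `M`, recurse on survivors. -/
noncomputable def recWinAux (E : ElimRule) : ℕ → ∀ n : ℕ, Outcome n → Fin n → ℝ
  | 0, n, _, _ => if n = 1 then 1 else 0
  | fuel + 1, n, o, i =>
    if n ≤ 1 then (if n = 1 then 1 else 0)
    else ∑ M : Finset (MatchPair n), E.d n M *
      (if h : i ∈ survivors o M then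
        recWinAux E fuel (survivors o M).card (restrictOutcome o (survivors o M))
          (((survivors o M).orderIsoOfFin rfl).symm ⟨i, h⟩)
      else 0)

/-- The recursive tournament rule `r^E` determined by the elimination rule `E`. -/
noncomputable def recWin (E : ElimRule) : ∀ n : ℕ, Outcome n → Fin n → ℝ :=
  fun n => recWinAux E n n

/-- `matchMem M u v`: the match between `u` and `v` belongs to `M`. -/
def matchMem {n : ℕ} (M : Finset (MatchPair n)) (u v : Fin n) : Prop :=
  ∃ e ∈ M, e.val = (u, v) ∨ e.val = (v, u)

/-- `valAfter r T M S`: the expected probability that the winner lies in `S` when the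
matches in `M` are played with outcomes drawn from `T`, the losers are eliminated, and
`r` is then run on the induced probabilistic subtournament `T|_M` of the survivors
(with the convention that eliminated teams win with probability `0`). -/
noncomputable def valAfter (r : ∀ n : ℕ, Outcome n → Fin n → ℝ) {n : ℕ}
    (T : ProbTournament n) (M : Finset (MatchPair n)) (S : Finset (Fin n)) : ℝ :=
  ∑ o : Outcome n, T.prob o *
    rPS r (restrictProb T (survivors o M)) (mapTeams (survivors o M) S)

/-- `U` is a base case for the manipulating coalition `S` under rule `r`:
no `S`-adjacent manipulation gains anything, i.e. `α_S^r(U) = 0`. -/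
def IsBaseCase (r : ∀ n : ℕ, Outcome n → Fin n → ℝ) {m : ℕ}
    (U : ProbTournament m) (S : Finset (Fin m)) : Prop :=
  ∀ U' : ProbTournament m, Adjacent S U U' → rPS r U' S - rPS r U S ≤ 0

/-! ## Gauntlets -/

/-- The tournament obtained from `o` by letting `u` beat every other team, keeping all
other matches intact. -/
def condorcetify {n : ℕ} (o : Outcome n) (u : Fin n) : Outcome n :=
  fun e => if e.val.1 = u then true else if e.val.2 = u then false else o e

/-- The opponents of `u` among the matches in `M`. -/
noncomputable def opponents {n : ℕ} (M : Finset (MatchPair n)) (u : Fin n) :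
    Finset (Fin n) :=
  (M.filter (fun e => e.val.1 = u)).image (fun e => e.val.2) ∪
  (M.filter (fun e => e.val.2 = u)).image (fun e => e.val.1)

/-- Fueled recursion for the distribution of the gauntlet of `u`: the set of opponents
that `u` plays in elimination matches when `r^E` is executed on a tournament in which
`u` beats everybody (the input `o` is assumed already so modified).  The value is the
probability, over the internal randomness of `E`, that the gauntlet equals `g`
(recorded as a set of teams of the outermost tournament). -/
noncomputable def gauntletDistAux (E : ElimRule) :
    ℕ → ∀ n : ℕ, Outcome n → Fin n → Finset (Fin n) → ℝ
  | 0, _, _, _, g => if g = ∅ then 1 else 0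
  | fuel + 1, n, o, u, g =>
    if n ≤ 1 then (if g = ∅ then 1 else 0)
    else ∑ M : Finset (MatchPair n), E.d n M *
      (if h : u ∈ survivors o M ∧ opponents M u ⊆ g ∧ g \ opponents M u ⊆ survivors o M then
        gauntletDistAux E fuel (survivors o M).card (restrictOutcome o (survivors o M))
          (((survivors o M).orderIsoOfFin rfl).symm ⟨u, h.1⟩)
          (Finset.univ.filter (fun a =>
            (↑((survivors o M).orderIsoOfFin rfl a) : Fin n) ∈ g \ opponents M u))
      else 0)

/-- `gauntletDist E n o u g`: the probability that the gauntlet `G^{r^E}_u(o)` of team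
`u` in the deterministic tournament `o` equals the set `g`. -/
noncomputable def gauntletDist (E : ElimRule) (n : ℕ) (o : Outcome n) (u : Fin n)
    (g : Finset (Fin n)) : ℝ :=
  gauntletDistAux E n n (condorcetify o u) u g

/-- `gauntletProbP E T u g`: the probability that the gauntlet `G^{r^E}_u(T)` of team `u`
in the independent probabilistic tournament `T` equals the set `g` (first sampling a
deterministic tournament from `T`, then the gauntlet). -/
noncomputable def gauntletProbP (E : ElimRule) {n : ℕ} (T : ProbTournament n)
    (u : Fin n) (g : Finset (Fin n)) : ℝ :=
  ∑ o : Outcome n, T.prob o * gauntletDist E n o u g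

/-- Given the first-round outcome `o` and matches `M`, the probability that the gauntlet
of team `x` in the surviving probabilistic subtournament `T|_M` equals the set `g`
(where `g` is recorded with the original team labels). -/
noncomputable def gauntletEventProb (E : ElimRule) {n : ℕ} (T : ProbTournament n)
    (M : Finset (MatchPair n)) (x : Fin n) (g : Finset (Fin n)) (o : Outcome n) : ℝ :=
  if h : x ∈ survivors o M ∧ g ⊆ survivors o M then
    gauntletProbP E (restrictProb T (survivors o M))
      (((survivors o M).orderIsoOfFin rfl).symm ⟨x, h.1⟩)
      (Finset.univ.filter (fun a =>
        (↑((survivors o M).orderIsoOfFin rfl a) : Fin n) ∈ g))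
  else 0

/-! ## Randomized Death Match -/

/-- Fueled recursion for Randomized Death Match: pick one of the `n.choose 2` matches
uniformly at random, eliminate the loser, recurse. -/
noncomputable def RDMAux : ℕ → ∀ n : ℕ, Outcome n → Fin n → ℝ
  | 0, n, _, _ => if n = 1 then 1 else 0
  | fuel + 1, n, o, i =>
    if n ≤ 1 then (if n = 1 then 1 else 0)
    else ((n.choose 2 : ℝ))⁻¹ * ∑ e : MatchPair n,
      (if h : i ∈ survivors o {e} then
        RDMAux fuel (survivors o {e}).card (restrictOutcome o (survivors o {e}))
          (((survivors o {e}).orderIsoOfFin rfl).symm ⟨i, h⟩)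
      else 0)

/-- Randomized Death Match. -/
noncomputable def RDM : ∀ n : ℕ, Outcome n → Fin n → ℝ :=
  fun n => RDMAux n n

/-! ## Randomized Single Elimination Bracket -/

/-- `nextPow2 n = 2 ^ ⌈log₂ n⌉`. -/
def nextPow2 (n : ℕ) : ℕ := 2 ^ Nat.clog 2 n

/-- Extend a tournament on `n` teams to `nextPow2 n` teams by adding dummy teams that
lose to all original teams (among themselves, the dummy with lower index wins). -/
def extendOutcome {n : ℕ} (o : Outcome n) : Outcome (nextPow2 n) :=
  fun e =>
    if h : (e.val.2 : ℕ) < n then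
      Outcome.beats o ⟨(e.val.1 : ℕ), lt_trans (Fin.lt_def.mp e.2) h⟩ ⟨(e.val.2 : ℕ), h⟩
    else true

/-- Fueled recursion for Randomized Single Elimination Bracket (after dummies have been
added): pick a uniformly random maximum matching on the remaining teams, play those
matches, eliminate all losers, recurse. -/
noncomputable def RSEBAux : ℕ → ∀ n : ℕ, Outcome n → Fin n → ℝ
  | 0, n, _, _ => if n = 1 then 1 else 0
  | fuel + 1, n, o, i =>
    if n ≤ 1 then (if n = 1 then 1 else 0)
    else
      ((Finset.univ.filter
          (fun M : Finset (MatchPair n) => IsMatchingSet M ∧ M.card = n / 2)).card : ℝ)⁻¹ *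
        ∑ M ∈ Finset.univ.filter
            (fun M : Finset (MatchPair n) => IsMatchingSet M ∧ M.card = n / 2),
          (if h : i ∈ survivors o M then
            RSEBAux fuel (survivors o M).card (restrictOutcome o (survivors o M))
              (((survivors o M).orderIsoOfFin rfl).symm ⟨i, h⟩)
          else 0)

/-- Randomized Single Elimination Bracket. -/
noncomputable def RSEB : ∀ n : ℕ, Outcome n → Fin n → ℝ :=
  fun n o i =>
    RSEBAux (nextPow2 n) (nextPow2 n) (extendOutcome o)
      (Fin.castLE (Nat.le_pow_clog one_lt_two n) i)

/-! ## Statement -/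

/-! ### Helper lemmas -/

/-- Real-valued indicator that `i` beats `j`. -/
noncomputable def beatInd {n : ℕ} (o : Outcome n) (i j : Fin n) : ℝ :=
  if Outcome.beats o i j = true then 1 else 0

theorem beats_swap {n : ℕ} (o : Outcome n) {i j : Fin n} (h : i ≠ j) :
    Outcome.beats o j i = !Outcome.beats o i j := by
  rcases lt_or_gt_of_ne h with h | h
  · simp [Outcome.beats, h, h.asymm]
  · simp [Outcome.beats, h, h.asymm]

theorem beats_restrict {n : ℕ} (o : Outcome n) (s : Finset (Fin n)) (a b : Fin s.card) :
    Outcome.beats (restrictOutcome o s) a b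
      = Outcome.beats o (↑(s.orderIsoOfFin rfl a)) (↑(s.orderIsoOfFin rfl b)) := by
  have hlt : ∀ a b : Fin s.card, a < b →
      ((s.orderIsoOfFin rfl a : Fin n) < (s.orderIsoOfFin rfl b : Fin n)) := by
    intro a b h
    exact (s.orderIsoOfFin rfl).strictMono h
  rcases lt_trichotomy a b with h | h | h
  · simp only [Outcome.beats, restrictOutcome, h, dif_pos]
  · subst h; simp [Outcome.beats]
  · have h1 := hlt _ _ h
    have h2 : ¬ a < b := h.asymm
    rw [Outcome.beats, dif_neg h2, dif_pos h]
    simp only [restrictOutcome]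
    rw [beats_swap o h1.ne]

theorem beats_cond {n : ℕ} (o : Outcome n) (u i j : Fin n) :
    Outcome.beats (condorcetify o u) i j
      = if i = j then false else if i = u then true else if j = u then false
        else Outcome.beats o i j := by
  rcases lt_trichotomy i j with h | h | h
  · have := h.ne
    simp [Outcome.beats, condorcetify, h, this]
  · subst h; simp [Outcome.beats]
  · have h1 := h.ne'
    have h2 := h.asymm
    simp only [Outcome.beats, condorcetify, h, h1, h2]
    by_cases hi : i = u
    · have : j ≠ u := fun hj => h1 (hi.trans hj.symm)
      simp [hi, this]
    · by_cases hj : j = u <;> simp [hi, hj]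

theorem outcome_ext {n : ℕ} {o o' : Outcome n}
    (h : ∀ i j, Outcome.beats o i j = Outcome.beats o' i j) : o = o' := by
  funext ⟨⟨i, j⟩, hij⟩
  have := h i j
  simpa [Outcome.beats, show i < j from hij] using this

theorem restrict_cond {n : ℕ} (o : Outcome n) (s : Finset (Fin n)) (w : Fin n) (hw : w ∈ s) :
    restrictOutcome (condorcetify o w) s
      = condorcetify (restrictOutcome o s) ((s.orderIsoOfFin rfl).symm ⟨w, hw⟩) := by
  apply outcome_ext
  intro i j
  have key : ∀ a : Fin s.card, ((s.orderIsoOfFin rfl a : Fin n) = w)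
      ↔ a = (s.orderIsoOfFin rfl).symm ⟨w, hw⟩ := by
    intro a
    rw [OrderIso.eq_symm_apply, Subtype.ext_iff]
  have key2 : ((s.orderIsoOfFin rfl i : Fin n) = (s.orderIsoOfFin rfl j : Fin n)) ↔ i = j := by
    rw [← Subtype.ext_iff, (s.orderIsoOfFin rfl).injective.eq_iff]
  rw [beats_restrict, beats_cond, beats_cond, beats_restrict]
  simp only [key, key2]

theorem mem_opponents {n : ℕ} (M : Finset (MatchPair n)) (u x : Fin n) :
    x ∈ opponents M u ↔ ∃ e ∈ M, (e.val.1 = u ∧ e.val.2 = x) ∨ (e.val.2 = u ∧ e.val.1 = x) := by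
  simp only [opponents, Finset.mem_union, Finset.mem_image, Finset.mem_filter]
  constructor
  · rintro (⟨e, ⟨h1, h2⟩, h3⟩ | ⟨e, ⟨h1, h2⟩, h3⟩)
    · exact ⟨e, h1, Or.inl ⟨h2, h3⟩⟩
    · exact ⟨e, h1, Or.inr ⟨h2, h3⟩⟩
  · rintro ⟨e, h1, ⟨h2, h3⟩ | ⟨h2, h3⟩⟩
    · exact Or.inl ⟨e, ⟨h1, h2⟩, h3⟩
    · exact Or.inr ⟨e, ⟨h1, h2⟩, h3⟩

theorem not_mem_opponents {n : ℕ} (M : Finset (MatchPair n)) (u : Fin n) :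
    u ∉ opponents M u := by
  rw [mem_opponents]
  rintro ⟨e, -, ⟨h1, h2⟩ | ⟨h1, h2⟩⟩
  · exact e.2.ne (h1.trans h2.symm)
  · exact e.2.ne (h2.trans h1.symm)

theorem opponents_symm {n : ℕ} (M : Finset (MatchPair n)) (u x : Fin n) :
    x ∈ opponents M u ↔ u ∈ opponents M x := by
  simp only [mem_opponents]
  constructor <;> rintro ⟨e, h1, h2⟩ <;> exact ⟨e, h1, by tauto⟩

theorem losesIn_iff {n : ℕ} (o : Outcome n) (M : Finset (MatchPair n)) (i : Fin n) :
    losesIn o M i ↔ ∃ x ∈ opponents M i, Outcome.beats o x i = true := by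
  simp only [mem_opponents, losesIn]
  constructor
  · rintro ⟨e, h1, ⟨h2, h3⟩ | ⟨h2, h3⟩⟩
    · exact ⟨_, ⟨e, h1, Or.inl ⟨h2, rfl⟩⟩, h3⟩
    · exact ⟨_, ⟨e, h1, Or.inr ⟨h2, rfl⟩⟩, h3⟩
  · rintro ⟨x, ⟨e, h1, ⟨h2, h3⟩ | ⟨h2, h3⟩⟩, h4⟩
    · exact ⟨e, h1, Or.inl ⟨h2, by rw [h3]; exact h4⟩⟩
    · exact ⟨e, h1, Or.inr ⟨h2, by rw [h3]; exact h4⟩⟩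

theorem mem_survivors {n : ℕ} (o : Outcome n) (M : Finset (MatchPair n)) (i : Fin n) :
    i ∈ survivors o M ↔ ∀ x ∈ opponents M i, Outcome.beats o x i = false := by
  simp [survivors, losesIn_iff]

theorem mem_survivors_cond {n : ℕ} (o : Outcome n) (M : Finset (MatchPair n)) (w : Fin n) :
    w ∈ survivors (condorcetify o w) M := by
  rw [mem_survivors]
  intro x hx
  have : x ≠ w := fun h => not_mem_opponents M w (h ▸ hx)
  simp [beats_cond, this]

theorem disjoint_survivors_cond {n : ℕ} (o : Outcome n) (M : Finset (MatchPair n)) (w : Fin n) :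
    Disjoint (opponents M w) (survivors (condorcetify o w) M) := by
  rw [Finset.disjoint_left]
  intro x hx hs
  have hne : w ≠ x := fun h => not_mem_opponents M w (h ▸ hx)
  rw [mem_survivors] at hs
  have := hs w ((opponents_symm _ _ _).1 hx)
  simp [beats_cond, hne] at this

theorem survivors_cond_eq {n : ℕ} (o : Outcome n) (M : Finset (MatchPair n)) (w : Fin n)
    (h : w ∈ survivors o M) : survivors (condorcetify o w) M = survivors o M := by
  ext i
  by_cases hi : i = w
  · subst hi
    exact iff_of_true (mem_survivors_cond o M i) h
  · simp only [mem_survivors] at h ⊢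
    refine forall₂_congr fun x hx => ?_
    have hxi : x ≠ i := fun e => not_mem_opponents M i (e ▸ hx)
    by_cases hxw : x = w
    · subst hxw
      have := h i ((opponents_symm _ _ _).1 hx)
      rw [beats_swap o hi] 
      simp [beats_cond, hxi, this]
    · simp [beats_cond, hxi, hi, hxw]

theorem prod_opponents_one {n : ℕ} (o : Outcome n) (M : Finset (MatchPair n)) (w : Fin n)
    (h : w ∈ survivors o M) : ∏ x ∈ opponents M w, beatInd o w x = 1 := by
  refine Finset.prod_eq_one fun x hx => ?_
  have hne : x ≠ w := fun e => not_mem_opponents M w (e ▸ hx)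
  have := (mem_survivors _ _ _).1 h x hx
  simp [beatInd, beats_swap o hne, this]

theorem prod_opponents_zero {n : ℕ} (o : Outcome n) (M : Finset (MatchPair n)) (w : Fin n)
    (h : w ∉ survivors o M) : ∏ x ∈ opponents M w, beatInd o w x = 0 := by
  rw [mem_survivors] at h
  push Not at h
  obtain ⟨x, hx, hb⟩ := h
  have hne : x ≠ w := fun e => not_mem_opponents M w (e ▸ hx)
  refine Finset.prod_eq_zero hx ?_
  simp only [ne_eq, Bool.not_eq_false] at hb
  simp [beatInd, beats_swap o hne, hb]

theorem survivors_card_lt {n : ℕ} (o : Outcome n) (M : Finset (MatchPair n))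
    (h : 1 ≤ M.card) : (survivors o M).card < n := by
  obtain ⟨e, he⟩ := Finset.card_pos.1 h
  have h1 : (e.val.2 : Fin n) ∈ opponents M e.val.1 := 
    (mem_opponents _ _ _).2 ⟨e, he, Or.inl ⟨rfl, rfl⟩⟩
  have h2 := (opponents_symm _ _ _).1 h1
  have hne : e.val.1 ≠ e.val.2 := e.2.ne
  have : ∃ i, i ∉ survivors o M := by
    by_contra hcon
    push Not at hcon
    have a := (mem_survivors _ _ _).1 (hcon e.val.1) _ h1
    have b := (mem_survivors _ _ _).1 (hcon e.val.2) _ h2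
    rw [beats_swap o hne, b] at a
    simp at a
  obtain ⟨i, hi⟩ := this
  have hlt := Finset.card_lt_univ_of_notMem hi
  simpa using hlt

theorem sum_reindex {n : ℕ} (s opp : Finset (Fin n)) (hd : Disjoint opp s)
    (F : Finset (Fin s.card) → ℝ) (b : Fin n → ℝ) :
    ∑ g : Finset (Fin n), (if opp ⊆ g ∧ g \ opp ⊆ s then
        F (Finset.univ.filter (fun a => (↑(s.orderIsoOfFin rfl a) : Fin n) ∈ g \ opp)) else 0)
        * ∏ x ∈ g, b x
      = (∏ x ∈ opp, b x) * ∑ g' : Finset (Fin s.card), F g' *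
          ∏ a ∈ g', b (↑(s.orderIsoOfFin rfl a)) := by
  have hinj : Function.Injective (fun a : Fin s.card => (s.orderIsoOfFin rfl a : Fin n)) :=
    fun a b h => (s.orderIsoOfFin rfl).injective (Subtype.ext h)
  rw [Finset.mul_sum]
  simp only [ite_mul, zero_mul]
  rw [← Finset.sum_filter]
  refine Finset.sum_bij' 
    (fun g _ => Finset.univ.filter (fun a => (↑(s.orderIsoOfFin rfl a) : Fin n) ∈ g \ opp))
    (fun g' _ => opp ∪ g'.image (fun a : Fin s.card => (s.orderIsoOfFin rfl a : Fin n)))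
    (fun _ _ => Finset.mem_univ _) ?_ ?_ ?_ ?_
  · intro g' _
    simp only [Finset.mem_filter, Finset.mem_univ, true_and]
    refine ⟨Finset.subset_union_left, ?_⟩
    intro x hx
    simp only [Finset.mem_sdiff, Finset.mem_union, Finset.mem_image] at hx
    obtain ⟨h | ⟨a, _, rfl⟩, h2⟩ := hx
    · exact absurd h h2
    · exact (s.orderIsoOfFin rfl a).2
  · intro g hg
    simp only [Finset.mem_filter, Finset.mem_univ, true_and] at hg
    ext x
    simp only [Finset.mem_union, Finset.mem_image, Finset.mem_filter, Finset.mem_univ, true_and,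
      Finset.mem_sdiff]
    constructor
    · rintro (h | ⟨a, ⟨h, _⟩, rfl⟩)
      · exact hg.1 h
      · exact h
    · intro hx
      by_cases ho : x ∈ opp
      · exact Or.inl ho
      · have hs : x ∈ s := hg.2 (Finset.mem_sdiff.2 ⟨hx, ho⟩)
        refine Or.inr ⟨(s.orderIsoOfFin rfl).symm ⟨x, hs⟩, ?_, ?_⟩ <;> simp [hx, ho]
  · intro g' _
    ext a
    have hns : (s.orderIsoOfFin rfl a : Fin n) ∉ opp :=
      fun h => Finset.disjoint_left.1 hd h (s.orderIsoOfFin rfl a).2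
    simp only [Finset.mem_union, Finset.mem_image, Finset.mem_filter, Finset.mem_univ, true_and,
      Finset.mem_sdiff]
    constructor
    · rintro ⟨h | ⟨c, hc, hca⟩, _⟩
      · exact absurd h hns
      · exact hinj hca ▸ hc
    · intro ha
      exact ⟨Or.inr ⟨a, ha, rfl⟩, hns⟩
  · intro g hg
    simp only [Finset.mem_filter, Finset.mem_univ, true_and] at hg
    have e1 : ∏ a ∈ Finset.univ.filter
          (fun a => (↑(s.orderIsoOfFin rfl a) : Fin n) ∈ g \ opp),
          b (↑(s.orderIsoOfFin rfl a)) = ∏ x ∈ g \ opp, b x := by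
      refine Finset.prod_bij (fun a _ => (s.orderIsoOfFin rfl a : Fin n)) ?_ ?_ ?_ ?_
      · intro a ha
        simpa only [Finset.mem_filter, Finset.mem_univ, true_and] using ha
      · intro a _ c _ h
        exact hinj h
      · intro x hx
        refine ⟨(s.orderIsoOfFin rfl).symm ⟨x, hg.2 hx⟩, ?_, ?_⟩
        · simp only [Finset.mem_filter, Finset.mem_univ, true_and, OrderIso.apply_symm_apply]
          exact hx
        · simp
      · intro a _
        rfl
    rw [e1, ← Finset.prod_sdiff hg.1]
    ring

/-- Pointwise identity: in a deterministic tournament `w` wins exactly when it beats all the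
members of its gauntlet. -/
theorem pointwise (E : ElimRule) : ∀ (fuel n : ℕ) (o : Outcome n) (w : Fin n), n ≤ fuel →
    recWinAux E fuel n o w
      = ∑ g : Finset (Fin n), gauntletDistAux E fuel n (condorcetify o w) w g
          * ∏ x ∈ g, beatInd o w x := by
  intro fuel
  induction fuel with
  | zero =>
    intro n o w h
    have := w.pos
    omega
  | succ fuel ih =>
    intro n o w h
    by_cases hn : n ≤ 1
    · have h1 : n = 1 := le_antisymm hn w.pos
      simp only [recWinAux, gauntletDistAux, hn, h1, if_true, ite_mul, one_mul, zero_mul,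
        Finset.sum_ite_eq', Finset.mem_univ, le_refl]
      simp
    · simp only [recWinAux, gauntletDistAux, hn, if_false]
      simp only [Finset.sum_mul]
      rw [Finset.sum_comm]
      refine Finset.sum_congr rfl fun M _ => ?_
      simp only [mul_assoc]
      rw [← Finset.mul_sum]
      by_cases hd : E.d n M = 0
      · simp [hd]
      congr 1
      have hM := (E.supp n M (by omega) hd).1
      have hwc := mem_survivors_cond o M w
      have hdisj := disjoint_survivors_cond o M w
      have hre := sum_reindex _ _ hdisj
        (gauntletDistAux E fuel _ (restrictOutcome (condorcetify o w)
          (survivors (condorcetify o w) M))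
          (((survivors (condorcetify o w) M).orderIsoOfFin rfl).symm ⟨w, hwc⟩))
        (fun x => beatInd o w x)
      simp only [hwc, true_and]
      refine Eq.trans ?_ (hre.symm.trans (Finset.sum_congr rfl fun g _ => ?_))
      swap
      · congr 1
      by_cases hw : w ∈ survivors o M
      · rw [dif_pos hw, prod_opponents_one o M w hw, one_mul]
        rw [ih _ _ _ (by have := survivors_card_lt o M hM; omega)]
        have hs := survivors_cond_eq o M w hw
        have gen : ∀ (s : Finset (Fin n)) (hs : s = survivors o M) (hws : w ∈ s),
            ∑ g : Finset (Fin (survivors o M).card),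
              gauntletDistAux E fuel (survivors o M).card
                (condorcetify (restrictOutcome o (survivors o M))
                  (((survivors o M).orderIsoOfFin rfl).symm ⟨w, hw⟩))
                (((survivors o M).orderIsoOfFin rfl).symm ⟨w, hw⟩) g *
                ∏ x ∈ g, beatInd (restrictOutcome o (survivors o M))
                  (((survivors o M).orderIsoOfFin rfl).symm ⟨w, hw⟩) x
            = ∑ g' : Finset (Fin s.card),
              gauntletDistAux E fuel s.card (restrictOutcome (condorcetify o w) s)
                ((s.orderIsoOfFin rfl).symm ⟨w, hws⟩) g' *
                ∏ a ∈ g', beatInd o w (↑(s.orderIsoOfFin rfl a)) := by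
          intro s hs hws
          subst hs
          rw [restrict_cond o _ w hws]
          simp only [beatInd, beats_restrict, OrderIso.apply_symm_apply]
        exact gen _ hs hwc
      · rw [dif_neg hw, prod_opponents_zero o M w hw, zero_mul]

theorem gauntlet_self (E : ElimRule) : ∀ (fuel n : ℕ) (o : Outcome n) (w : Fin n)
    (g : Finset (Fin n)), w ∈ g → gauntletDistAux E fuel n o w g = 0 := by
  intro fuel
  induction fuel with
  | zero =>
    intro n o w g h
    have : g ≠ ∅ := Finset.ne_empty_of_mem h
    simp [gauntletDistAux, this]
  | succ fuel ih =>
    intro n o w g h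
    have hg : g ≠ ∅ := Finset.ne_empty_of_mem h
    by_cases hn : n ≤ 1
    · simp only [gauntletDistAux, hn, hg, if_true, if_false]
    · simp only [gauntletDistAux, hn, if_false]
      refine Finset.sum_eq_zero fun M _ => ?_
      split_ifs with hc
      · rw [ih, mul_zero]
        simp only [Finset.mem_filter, Finset.mem_univ, true_and, OrderIso.apply_symm_apply,
          Finset.mem_sdiff]
        exact ⟨h, not_mem_opponents M w⟩
      · simp

/-- Flip the result of one match. -/
noncomputable def flipAt {n : ℕ} (e : MatchPair n) (o : Outcome n) : Outcome n :=
  Function.update o e (!o e)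

theorem flipAt_invol {n : ℕ} (e : MatchPair n) : Function.Involutive (flipAt e) := by
  intro o
  simp [flipAt]

theorem single_match {n : ℕ} (T : ProbTournament n) (e : MatchPair n) (c : Bool)
    (h : Outcome n → ℝ) (hh : ∀ o, h (flipAt e o) = h o) :
    ∑ o : Outcome n, T.prob o * (h o * if o e = c then 1 else 0)
      = (if c then T.p e.val.1 e.val.2 else T.p e.val.2 e.val.1) *
        ∑ o : Outcome n, T.prob o * h o := by
  set W : Outcome n → ℝ := fun o => ∏ e' ∈ Finset.univ.erase e,
    (if o e' then T.p e'.val.1 e'.val.2 else T.p e'.val.2 e'.val.1) with hW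
  have hWf : ∀ o, W (flipAt e o) = W o := by
    intro o
    refine Finset.prod_congr rfl fun e' he' => ?_
    have : e' ≠ e := Finset.ne_of_mem_erase he'
    simp [flipAt, Function.update_of_ne this]
  have hp : ∀ o, T.prob o
      = (if o e then T.p e.val.1 e.val.2 else T.p e.val.2 e.val.1) * W o := by
    intro o
    exact (Finset.mul_prod_erase Finset.univ
      (fun e' : MatchPair n => if o e' then T.p e'.val.1 e'.val.2 else T.p e'.val.2 e'.val.1)
      (Finset.mem_univ e)).symm
  set A : ℝ := ∑ o : Outcome n, W o * h o * (if o e = true then 1 else 0) with hA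
  set B : ℝ := ∑ o : Outcome n, W o * h o * (if o e = false then 1 else 0) with hB
  have hAB : A = B := by
    rw [hA, hB, ← Equiv.sum_comp (flipAt_invol e).toPerm]
    refine Finset.sum_congr rfl fun o _ => ?_
    simp only [Function.Involutive.coe_toPerm, hWf, hh]
    simp [flipAt]
  have hc := T.compl e.val.1 e.val.2 e.2.ne
  have htot : ∑ o : Outcome n, T.prob o * h o
      = T.p e.val.1 e.val.2 * A + T.p e.val.2 e.val.1 * B := by
    rw [hA, hB, Finset.mul_sum, Finset.mul_sum, ← Finset.sum_add_distrib]
    refine Finset.sum_congr rfl fun o _ => ?_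
    rw [hp]
    cases o e <;> simp <;> ring
  have htotA : ∑ o : Outcome n, T.prob o * h o = A := by
    rw [htot, ← hAB, ← add_mul, hc, one_mul]
  rw [htotA]
  cases c
  · rw [hAB, hB, Finset.mul_sum]
    refine Finset.sum_congr rfl fun o _ => ?_
    rw [hp]
    cases o e <;> simp <;> ring
  · rw [hA, Finset.mul_sum]
    refine Finset.sum_congr rfl fun o _ => ?_
    rw [hp]
    cases o e <;> simp <;> ring

/-- The unordered match between `w` and `x`. -/
theorem exists_match {n : ℕ} (w x : Fin n) (hne : x ≠ w) :
    ∃ (e : MatchPair n) (c : Bool),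
      (∀ o : Outcome n, beatInd o w x = if o e = c then 1 else 0) ∧
      (∀ T : ProbTournament n,
        (if c then T.p e.val.1 e.val.2 else T.p e.val.2 e.val.1) = T.p w x) ∧
      (∀ o : Outcome n, condorcetify (flipAt e o) w = condorcetify o w) ∧
      (∀ (o : Outcome n) (y : Fin n), y ≠ x → beatInd (flipAt e o) w y = beatInd o w y) := by
  rcases lt_or_gt_of_ne hne with h | h
  · refine ⟨⟨(x, w), h⟩, false, ?_, ?_, ?_, ?_⟩
    · intro o
      simp [beatInd, Outcome.beats, h, h.asymm]
    · intro T; simp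
    · intro o
      funext e'
      by_cases he : e' = ⟨(x, w), h⟩
      · subst he; simp [condorcetify, hne]
      · simp [condorcetify, flipAt, Function.update_of_ne he]
    · intro o y hy
      simp [beatInd, Outcome.beats, flipAt, Function.update_apply, hy, hne.symm]
      rfl
  · refine ⟨⟨(w, x), h⟩, true, ?_, ?_, ?_, ?_⟩
    · intro o
      simp [beatInd, Outcome.beats, h]
    · intro T; simp
    · intro o
      funext e'
      by_cases he : e' = ⟨(w, x), h⟩
      · subst he; simp [condorcetify]
      · simp [condorcetify, flipAt, Function.update_of_ne he]
    · intro o y hy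
      simp [beatInd, Outcome.beats, flipAt, Function.update_apply, hy, hne.symm]
      rfl

theorem expect_prod {n : ℕ} (T : ProbTournament n) (w : Fin n) (f : Outcome n → ℝ)
    (g : Finset (Fin n)) (hw : w ∉ g) :
    ∑ o : Outcome n, T.prob o * (f (condorcetify o w) * ∏ x ∈ g, beatInd o w x)
      = (∑ o : Outcome n, T.prob o * f (condorcetify o w)) * ∏ x ∈ g, T.p w x := by
  induction g using Finset.induction_on with
  | empty => simp
  | insert x g hx ih =>
    have hwx : x ≠ w := fun h => hw (h ▸ Finset.mem_insert_self _ _)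
    have hwg : w ∉ g := fun h => hw (Finset.mem_insert_of_mem h)
    obtain ⟨e, c, h1, h2, h3, h4⟩ := exists_match w x hwx
    have key := single_match T e c
      (fun o => f (condorcetify o w) * ∏ x ∈ g, beatInd o w x) (by
        intro o
        simp only [h3]
        congr 1
        refine Finset.prod_congr rfl fun y hy => h4 o y ?_
        rintro rfl
        exact hx hy)
    rw [h2, ih hwg] at key
    rw [Finset.prod_insert hx]
    calc _ = ∑ o : Outcome n, T.prob o *
          ((f (condorcetify o w) * ∏ x ∈ g, beatInd o w x) * if o e = c then 1 else 0) := by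
          refine Finset.sum_congr rfl fun o _ => ?_
          rw [Finset.prod_insert hx, h1 o]
          ring
      _ = _ := by rw [key]; ring

theorem stmt13 (E : ElimRule) {n : ℕ} (T : ProbTournament n) (w : Fin n) :
    rP (recWin E) T w
      = ∑ g : Finset (Fin n), gauntletProbP E T w g * ∏ x ∈ g, T.p w x := by
  simp only [rP, recWin, pointwise E n n _ w le_rfl, Finset.mul_sum]
  rw [Finset.sum_comm]
  refine Finset.sum_congr rfl fun g _ => ?_
  simp only [gauntletProbP, gauntletDist]
  by_cases hw : w ∈ g
  · simp [gauntlet_self E n n _ w g hw]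
  · exact expect_prod T w (fun o => gauntletDistAux E n n o w g) g hw
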